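/- arXiv:2312.05010 — 2 statements merged into one kernel-verified Lean document; each statement's English description precedes it below -/
import Mathlib

section
/- Let G be a 3-connected simple graph, let u and v be distinct vertices of G, and let e_u be an edge of G with endpoints u and u', and e_v an edge of G with endpoints v and v'. Then there exist three pairwise internally vertex-disjoint paths P₁, P₂, P₃ from u to v such that both e_u and e_v are edges of P₁ ∪ P₂ ∪ P₃ (i.e., each of e_u and e_v is an edge of at least one of the three paths). -/
open SimpleGraph

/-- Two `u`–`v` walks are internally vertex-disjoint if every vertex they have in
common is `u` or `v`. -/
def InternallyDisjoint {V : Type*} {G : SimpleGraph V} {u v : V}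
    (p q : G.Walk u v) : Prop :=
  ∀ w, w ∈ p.support → w ∈ q.support → w = u ∨ w = v

/-- A finite simple graph is 3-connected if it has at least 4 vertices and deleting
any set of at most 2 vertices leaves a connected graph. -/
def ThreeConnected {V : Type*} [Fintype V] (G : SimpleGraph V) : Prop :=
  4 ≤ Fintype.card V ∧
    ∀ S : Set V, S.ncard ≤ 2 → (G.induce Sᶜ).Connected

/-- In a preconnected graph, a set of vertices that is closed under adjacency and contains one
vertex contains every vertex. -/
theorem SimpleGraph.Preconnected.mem_of_adj_closed {α : Type*} {H : SimpleGraph α}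
    (hH : H.Preconnected) {W : Set α} (hW : ∀ a ∈ W, ∀ b, H.Adj a b → b ∈ W)
    {a : α} (ha : a ∈ W) (b : α) : b ∈ W := by
  obtain ⟨p⟩ := hH a b
  induction p with
  | nil => exact ha
  | cons h _ ih => exact ih (hW _ ha _ h)

/-- An injective self-map of `α ⊕ ι` that moves vertices of `α` along edges of `H` (or fixes them)
and maps `ι` into `α` yields disjoint paths of `H`: follow the orbit of each `i : ι` until it
returns to `ι`. -/
theorem exists_disjoint_paths_of_injective {α ι : Type*} [Finite α] [Finite ι]
    (H : SimpleGraph α) (f : α ⊕ ι → α ⊕ ι) (hf : Function.Injective f)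
    (hadj : ∀ a b, f (Sum.inl a) = Sum.inl b → a = b ∨ H.Adj a b)
    (hsrc : ∀ i j, f (Sum.inr i) ≠ Sum.inr j) :
    ∃ (a b : ι → α) (τ : ι → ι) (R : ∀ i, H.Walk (a i) (b i)),
      (∀ i, (R i).IsPath) ∧
      (∀ i j, i ≠ j → ∀ w, w ∈ (R i).support → w ∉ (R j).support) ∧
      (∀ i, f (Sum.inr i) = Sum.inl (a i)) ∧
      (∀ i, f (Sum.inl (b i)) = Sum.inr (τ i)) ∧ Function.Surjective τ := by
  classical
  have hret : ∀ i, ∃ n, ∃ j, f^[n + 1] (Sum.inr i) = Sum.inr j := by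
    intro i
    obtain ⟨n, hn, hp⟩ := (hf.mem_periodicPts (Sum.inr i) :)
    exact ⟨n - 1, i, by rw [Nat.sub_add_cancel hn]; exact hp⟩
  let n : ι → ℕ := fun i => Nat.find (hret i)
  have hn : ∀ i, ∃ j, f^[n i + 1] (Sum.inr i) = Sum.inr j := fun i => Nat.find_spec (hret i)
  have hmin : ∀ i m, m < n i → ∃ a, f^[m + 1] (Sum.inr i) = Sum.inl a := by
    intro i m hm
    have := Nat.find_min (hret i) hm
    rcases h : f^[m + 1] (Sum.inr i) with a | j
    · exact ⟨a, rfl⟩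
    · exact absurd ⟨j, h⟩ this
  have hpos : ∀ i, 0 < n i := by
    intro i
    by_contra h0
    obtain ⟨j, hj⟩ := hn i
    rw [Nat.eq_zero_of_not_pos h0] at hj
    exact hsrc i j hj
  have huniq_le : ∀ i j s t, s ≤ t → t ≤ n j →
      f^[s + 1] (Sum.inr i) = f^[t + 1] (Sum.inr j) → i = j := by
    intro i j s t hst ht h
    obtain ⟨d, rfl⟩ := Nat.exists_eq_add_of_le hst
    rw [show s + d + 1 = (s + 1) + d by omega, Function.iterate_add_apply f (s + 1)] at h
    have h' := hf.iterate (s + 1) h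
    cases d with
    | zero => exact Sum.inr_injective h'
    | succ d =>
      obtain ⟨a, ha⟩ := hmin j d (by omega)
      rw [ha] at h'
      cases h'
  have huniq : ∀ i j s t, s ≤ n i → t ≤ n j →
      f^[s + 1] (Sum.inr i) = f^[t + 1] (Sum.inr j) → i = j := by
    intro i j s t hs ht h
    rcases le_total s t with hst | hst
    · exact huniq_le i j s t hst ht h
    · exact (huniq_le j i t s hst hs h.symm).symm
  choose a ha using fun i => hmin i 0 (hpos i)
  choose b hb using fun i => hmin i (n i - 1) (Nat.sub_lt (hpos i) one_pos)
  choose τ hτ using hn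
  have hwalk : ∀ i m, m < n i → ∀ c, f^[m + 1] (Sum.inr i) = Sum.inl c →
      ∃ p : H.Walk (a i) c, ∀ w ∈ p.support, ∃ s < n i, f^[s + 1] (Sum.inr i) = Sum.inl w := by
    intro i m
    induction m with
    | zero =>
      intro hm c hc
      obtain rfl : a i = c := Sum.inl_injective ((ha i).symm.trans hc)
      refine ⟨Walk.nil, fun w hw => ⟨0, hm, ?_⟩⟩
      rw [Walk.support_nil, List.mem_singleton] at hw
      rw [hw, hc]
    | succ m ih =>
      intro hm c hc
      obtain ⟨d, hd⟩ := hmin i m (by omega)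
      obtain ⟨p, hp⟩ := ih (by omega) d hd
      have hdc : f (Sum.inl d) = Sum.inl c := by
        rw [← hd, ← Function.iterate_succ_apply' f, hc]
      rcases hadj d c hdc with rfl | h
      · exact ⟨p, hp⟩
      · refine ⟨p.concat h, fun w hw => ?_⟩
        rw [Walk.support_concat, List.mem_append, List.mem_singleton] at hw
        rcases hw with hw | rfl
        · exact hp w hw
        · exact ⟨m + 1, hm, hc⟩
  choose p hp using fun i => hwalk i (n i - 1) (Nat.sub_lt (hpos i) one_pos) (b i) (hb i)
  refine ⟨a, b, τ, fun i => (p i).bypass, fun i => (p i).bypass_isPath, ?_, ha, ?_, ?_⟩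
  · intro i j hij w hi hj
    obtain ⟨s, hs, hs'⟩ := hp i w ((p i).support_bypass_subset_support hi)
    obtain ⟨t, ht, ht'⟩ := hp j w ((p j).support_bypass_subset_support hj)
    exact hij (huniq i j s t hs.le ht.le (hs'.trans ht'.symm))
  · intro i
    have h := hτ i
    rw [Function.iterate_succ_apply'] at h
    have h' := hb i
    rw [show n i - 1 + 1 = n i from Nat.sub_add_cancel (hpos i)] at h'
    rwa [h'] at h
  · refine Finite.surjective_of_injective fun i j hij => ?_
    exact huniq i j (n i) (n j) le_rfl le_rfl (by rw [hτ, hτ, hij])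

/-- Hall's theorem applied to a vertex-split copy of `G`: the injection encodes three disjoint
`u`–`v` paths, one leaving `u` through `u'` and one entering `v` through `v'`. -/
theorem ThreeConnected.exists_injective {V : Type*} [Fintype V] {G : SimpleGraph V}
    (hG : ThreeConnected G) {u v : V} (huv : u ≠ v) (hnadj : ¬ G.Adj u v)
    (u' v' : ↥({u, v}ᶜ : Set V)) (heu : G.Adj u u') (hev : G.Adj v v') :
    ∃ f : ↥({u, v}ᶜ : Set V) ⊕ Fin 3 → ↥({u, v}ᶜ : Set V) ⊕ Fin 3, Function.Injective f ∧
      (∀ a b, f (Sum.inl a) = Sum.inl b → a = b ∨ (G.induce {u, v}ᶜ).Adj a b) ∧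
      (∀ a j, f (Sum.inl a) = Sum.inr j → G.Adj v a ∧ (j = 0 → a = v')) ∧
      (∀ i b, f (Sum.inr i) = Sum.inl b → G.Adj u b ∧ (i = 0 → b = u')) ∧
      (∀ i j, f (Sum.inr i) ≠ Sum.inr j) := by
  classical
  let r : ↥({u, v}ᶜ : Set V) ⊕ Fin 3 → ↥({u, v}ᶜ : Set V) ⊕ Fin 3 → Prop := fun x y =>
    match x, y with
    | Sum.inl a, Sum.inl b => a = b ∨ (G.induce {u, v}ᶜ).Adj a b
    | Sum.inl a, Sum.inr j => G.Adj v a ∧ (j = 0 → a = v')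
    | Sum.inr i, Sum.inl b => G.Adj u b ∧ (i = 0 → b = u')
    | Sum.inr _, Sum.inr _ => False
  let t : ↥({u, v}ᶜ : Set V) ⊕ Fin 3 → Finset (↥({u, v}ᶜ : Set V) ⊕ Fin 3) :=
    fun x => Finset.univ.filter (r x)
  have hH : (G.induce ({u, v}ᶜ : Set V)).Preconnected :=
    (hG.2 {u, v} (Set.ncard_pair huv).le).preconnected
  suffices hall : ∀ s : Finset (↥({u, v}ᶜ : Set V) ⊕ Fin 3), s.card ≤ (s.biUnion t).card by
    obtain ⟨f, hf, hft⟩ := (Finset.all_card_le_biUnion_card_iff_exists_injective t).1 hall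
    have hr : ∀ x, r x (f x) := fun x => (Finset.mem_filter.1 (hft x)).2
    refine ⟨f, hf, fun a b h => ?_, fun a j h => ?_, fun i b h => ?_, fun i j h => ?_⟩
    · simpa only [r, h] using hr (Sum.inl a)
    · simpa only [r, h] using hr (Sum.inl a)
    · simpa only [r, h] using hr (Sum.inr i)
    · simpa only [r, h] using hr (Sum.inr i)
  intro s
  have hmem : ∀ x ∈ s, ∀ y, r x y → y ∈ s.biUnion t := fun x hx y hxy =>
    Finset.mem_biUnion.2 ⟨x, hx, Finset.mem_filter.2 ⟨Finset.mem_univ _, hxy⟩⟩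
  generalize s.biUnion t = N at hmem
  rw [← s.card_toLeft_add_card_toRight, ← N.card_toLeft_add_card_toRight]
  have hWT : s.toLeft ⊆ N.toLeft := fun a ha =>
    Finset.mem_toLeft.2 (hmem _ (Finset.mem_toLeft.1 ha) (Sum.inl a) (Or.inl rfl))
  have hnbr : ∀ a ∈ s.toLeft, ∀ b, (G.induce ({u, v}ᶜ : Set V)).Adj a b → b ∈ N.toLeft :=
    fun a ha b hab =>
      Finset.mem_toLeft.2 (hmem _ (Finset.mem_toLeft.1 ha) (Sum.inl b) (Or.inr hab))
  have hsink : ∀ a ∈ s.toLeft, G.Adj v a → ∀ j, (j = 0 → a = v') → j ∈ N.toRight :=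
    fun a ha hav j hj =>
      Finset.mem_toRight.2 (hmem _ (Finset.mem_toLeft.1 ha) (Sum.inr j) ⟨hav, hj⟩)
  have hsource : ∀ i ∈ s.toRight, ∀ b : ↥({u, v}ᶜ : Set V), G.Adj u b → (i = 0 → b = u') →
      b ∈ N.toLeft := fun i hi b hb hi0 =>
    Finset.mem_toLeft.2 (hmem _ (Finset.mem_toRight.1 hi) (Sum.inl b) ⟨hb, hi0⟩)
  have hcard := Finset.card_le_card hWT
  have hJ3 : s.toRight.card ≤ 3 := by simpa using s.toRight.card_le_univ
  by_cases hv' : v' ∈ s.toLeft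
  · have hK : N.toRight = Finset.univ :=
      Finset.eq_univ_of_forall fun j => hsink v' hv' hev j fun _ => rfl
    have hK3 : N.toRight.card = 3 := by simp [hK]
    omega
  rcases s.toRight.eq_empty_or_nonempty with hJ | ⟨i₀, hi₀⟩
  · rw [hJ, Finset.card_empty]
    omega
  have hlt : s.toLeft.card < N.toLeft.card := by
    refine Finset.card_lt_card (hWT.ssubset_of_ne fun heq => hv' ?_)
    have hu' : u' ∈ s.toLeft := heq ▸ hsource i₀ hi₀ u' heu fun _ => rfl
    exact hH.mem_of_adj_closed (W := {x | x ∈ s.toLeft})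
      (fun a ha b hab => show b ∈ s.toLeft from heq ▸ hnbr a ha b hab) hu' v'
  by_cases hJ0 : s.toRight ⊆ {0}
  · have := Finset.card_le_card hJ0
    rw [Finset.card_singleton] at this
    omega
  obtain ⟨i, hi, hi0⟩ := Finset.not_subset.1 hJ0
  rw [Finset.mem_singleton] at hi0
  have hNu : ∀ b : ↥({u, v}ᶜ : Set V), G.Adj u b → b ∈ N.toLeft :=
    fun b hb => hsource i hi b hb fun h => absurd h hi0
  by_cases hv : ∃ a ∈ s.toLeft, G.Adj v a
  · obtain ⟨a, ha, hav⟩ := hv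
    have hK : ({1, 2} : Finset (Fin 3)) ⊆ N.toRight := by
      intro j hj
      refine hsink a ha hav j fun h => ?_
      subst h
      simp at hj
    have hK2 : 2 ≤ N.toRight.card := Finset.card_le_card hK
    omega
  push Not at hv
  suffices h3 : 3 ≤ (N.toLeft \ s.toLeft).card by
    have := Finset.card_sdiff_add_card_eq_card hWT
    omega
  by_contra h3
  let S : Set V := Subtype.val '' (↑(N.toLeft \ s.toLeft) : Set ↥({u, v}ᶜ : Set V))
  have hS : S.ncard ≤ 2 := by
    have := Set.ncard_image_le (f := Subtype.val)
      (Finset.finite_toSet (N.toLeft \ s.toLeft))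
    rw [Set.ncard_coe_finset] at this
    exact this.trans (by omega)
  have huS : u ∈ Sᶜ := by
    rintro ⟨x, -, hx⟩
    exact x.2 (Or.inl hx)
  have hvS : v ∈ Sᶜ := by
    rintro ⟨x, -, hx⟩
    exact x.2 (Or.inr hx)
  let C : Set ↥(Sᶜ) := {x | x.1 = u ∨ ∃ a ∈ s.toLeft, x.1 = a.1}
  have hC : ∀ x ∈ C, ∀ y, (G.induce Sᶜ).Adj x y → y ∈ C := by
    intro x hx y hxy
    have hxy' : G.Adj x.1 y.1 := hxy
    by_cases hyu : y.1 = u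
    · exact Or.inl hyu
    have hyv : y.1 ≠ v := by
      rintro hyv
      rw [hyv] at hxy'
      rcases hx with hx | ⟨a, ha, hx⟩
      · exact hnadj (hx ▸ hxy')
      · exact hv a ha (hx ▸ hxy'.symm)
    let y' : ↥({u, v}ᶜ : Set V) := ⟨y.1, fun h => h.elim hyu hyv⟩
    have hyN : y' ∈ N.toLeft := by
      rcases hx with hx | ⟨a, ha, hx⟩
      · rw [hx] at hxy'
        exact hNu y' hxy'
      · rw [hx] at hxy'
        exact hnbr a ha y' hxy'
    refine Or.inr ⟨y', ?_, rfl⟩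
    by_contra hys
    exact y.2 ⟨y', Finset.mem_coe.2 (Finset.mem_sdiff.2 ⟨hyN, hys⟩), rfl⟩
  have hvC : (⟨v, hvS⟩ : ↥(Sᶜ)) ∈ C :=
    (hG.2 S hS).preconnected.mem_of_adj_closed hC (a := ⟨u, huS⟩) (Or.inl rfl) _
  rcases hvC with h | ⟨a, -, h⟩
  · exact huv h.symm
  · exact a.2 (Or.inr h.symm)

/-- Extending a path of `G - {u, v}` at its two ends to a `u`–`v` path. -/
theorem exists_path_through_induce {V : Type*} {G : SimpleGraph V} {u v : V} (huv : u ≠ v)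
    {a b : ↥({u, v}ᶜ : Set V)} (ha : G.Adj u a) (hb : G.Adj v b)
    (R : (G.induce ({u, v}ᶜ : Set V)).Walk a b) (hR : R.IsPath) :
    ∃ P : G.Walk u v, P.IsPath ∧ s(u, a.1) ∈ P.edges ∧ s(v, b.1) ∈ P.edges ∧
      ∀ w ∈ P.support, w = u ∨ w = v ∨ ∃ x ∈ R.support, w = x.1 := by
  let Q : G.Walk a.1 b.1 := R.map (Embedding.induce _).toHom
  have hQ : Q.IsPath := hR.map Subtype.val_injective
  have hQs : ∀ w ∈ Q.support, ∃ x ∈ R.support, w = x.1 := by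
    intro w hw
    obtain ⟨x, hx, rfl⟩ := List.mem_map.1 ((Walk.support_map _ R) ▸ hw :)
    exact ⟨x, hx, rfl⟩
  have huQ : u ∉ Q.support := fun h => by
    obtain ⟨x, -, hx⟩ := hQs u h
    exact x.2 (Or.inl hx.symm)
  have hvQ : v ∉ Q.support := fun h => by
    obtain ⟨x, -, hx⟩ := hQs v h
    exact x.2 (Or.inr hx.symm)
  refine ⟨Walk.cons ha (Q.concat hb.symm), ?_, ?_, ?_, ?_⟩
  · rw [Walk.cons_isPath_iff]
    refine ⟨hQ.concat hvQ hb.symm, ?_⟩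
    simp [Walk.support_concat, huQ, huv]
  · simp
  · simp [Walk.edges_concat, Sym2.eq_swap]
  · intro w hw
    simp only [Walk.support_cons, Walk.support_concat, List.mem_cons,
      List.mem_append, List.not_mem_nil, or_false] at hw
    rcases hw with h | h | h
    · exact Or.inl h
    · exact Or.inr (Or.inr (hQs w h))
    · exact Or.inr (Or.inl h)

/-- Every vertex of a 3-connected graph has a neighbour different from any given vertex. -/
theorem ThreeConnected.exists_adj_ne {V : Type*} [Fintype V] {G : SimpleGraph V}
    (hG : ThreeConnected G) {u v : V} (huv : u ≠ v) : ∃ w, G.Adj u w ∧ w ≠ v := by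
  classical
  by_contra! h
  have hconn := (hG.2 {v} (by simp)).preconnected
  have hu : u ∈ ({v}ᶜ : Set V) := huv
  obtain ⟨x, -, hx⟩ := Finset.exists_mem_notMem_of_card_lt_card
    (s := {u, v}) (t := (Finset.univ : Finset V))
    (Finset.card_le_two.trans_lt (by rw [Finset.card_univ]; have := hG.1; omega))
  simp only [Finset.mem_insert, Finset.mem_singleton, not_or] at hx
  have := hconn.mem_of_adj_closed (W := {⟨u, hu⟩}) (a := ⟨u, hu⟩)
    (fun y hy z hyz => by
      rw [Set.mem_singleton_iff] at hy
      subst hy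
      exact absurd (h z.1 hyz) z.2) rfl ⟨x, hx.2⟩
  exact hx.1 (congrArg Subtype.val (Set.mem_singleton_iff.1 this))

theorem stmt_0 {V : Type*} [Fintype V] (G : SimpleGraph V)
    (hG : ThreeConnected G) (u v u' v' : V) (huv : u ≠ v)
    (heu : G.Adj u u') (hev : G.Adj v v') :
    ∃ P₁ P₂ P₃ : G.Walk u v,
      P₁.IsPath ∧ P₂.IsPath ∧ P₃.IsPath ∧
      InternallyDisjoint P₁ P₂ ∧ InternallyDisjoint P₁ P₃ ∧
      InternallyDisjoint P₂ P₃ ∧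
      (s(u, u') ∈ P₁.edges ∨ s(u, u') ∈ P₂.edges ∨ s(u, u') ∈ P₃.edges) ∧
      (s(v, v') ∈ P₁.edges ∨ s(v, v') ∈ P₂.edges ∨ s(v, v') ∈ P₃.edges) := by
  by_cases hnadj : G.Adj u v
  · have key : ∀ x, G.Adj u x → ∀ y, G.Adj v y → x ≠ v → y ≠ u → ∃ P : G.Walk u v,
        P.IsPath ∧ s(u, x) ∈ P.edges ∧ s(v, y) ∈ P.edges := by
      intro x hx y hy hxv hyu
      obtain ⟨R, hR⟩ := ((hG.2 {u, v} (Set.ncard_pair huv).le).preconnected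
        ⟨x, by simp [hx.ne', hxv]⟩ ⟨y, by simp [hy.ne', hyu]⟩).exists_isPath
      obtain ⟨P, hP, hPx, hPy, -⟩ := exists_path_through_induce huv hx hy R hR
      exact ⟨P, hP, hPx, hPy⟩
    obtain ⟨x, hx, hxv, hxu'⟩ : ∃ x, G.Adj u x ∧ x ≠ v ∧ (u' ≠ v → x = u') := by
      by_cases h : u' = v
      · obtain ⟨x, hx, hxv⟩ := hG.exists_adj_ne huv
        exact ⟨x, hx, hxv, fun h' => absurd h h'⟩
      · exact ⟨u', heu, h, fun _ => rfl⟩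
    obtain ⟨y, hy, hyu, hyv'⟩ : ∃ y, G.Adj v y ∧ y ≠ u ∧ (v' ≠ u → y = v') := by
      by_cases h : v' = u
      · obtain ⟨y, hy, hyu⟩ := hG.exists_adj_ne huv.symm
        exact ⟨y, hy, hyu, fun h' => absurd h h'⟩
      · exact ⟨v', hev, h, fun _ => rfl⟩
    obtain ⟨P, hP, hPx, hPy⟩ := key x hx y hy hxv hyu
    have hE : ∀ w, w ∈ hnadj.toWalk.support → w = u ∨ w = v := by simp
    refine ⟨P, hnadj.toWalk, hnadj.toWalk, hP, ?_, ?_, fun w _ => hE w, fun w _ => hE w,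
      fun w _ => hE w, ?_, ?_⟩
    · simp [huv]
    · simp [huv]
    · by_cases h : u' = v
      · subst h
        simp
      · exact Or.inl (hxu' h ▸ hPx)
    · by_cases h : v' = u
      · subst h
        simp [Sym2.eq_swap]
      · exact Or.inl (hyv' h ▸ hPy)
  have hu' : u' ∈ ({u, v}ᶜ : Set V) := by
    simpa [heu.ne'] using fun h : u' = v => hnadj (h ▸ heu)
  have hv' : v' ∈ ({u, v}ᶜ : Set V) := by
    simpa [hev.ne'] using fun h : v' = u => hnadj (h ▸ hev.symm)
  obtain ⟨f, hf, hadj, hsink, hsource, hne⟩ :=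
    hG.exists_injective huv hnadj ⟨u', hu'⟩ ⟨v', hv'⟩ heu hev
  obtain ⟨a, b, τ, R, hR, hdisj, ha, hb, hτ⟩ :=
    exists_disjoint_paths_of_injective _ f hf hadj hne
  choose P hP hPa hPb hPs using fun i =>
    exists_path_through_induce huv (hsource i _ (ha i)).1 (hsink _ _ (hb i)).1 (R i) (hR i)
  have hPd : ∀ i j, i ≠ j → InternallyDisjoint (P i) (P j) := by
    intro i j hij w hi hj
    rcases hPs i w hi with h | h | ⟨x, hx, rfl⟩
    · exact Or.inl h
    · exact Or.inr h
    rcases hPs j x.1 hj with h | h | ⟨y, hy, hxy⟩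
    · exact Or.inl h
    · exact Or.inr h
    · exact absurd (Subtype.ext hxy ▸ hy) (hdisj i j hij x hx)
  refine ⟨P 0, P 1, P 2, hP 0, hP 1, hP 2, hPd 0 1 (by decide), hPd 0 2 (by decide),
    hPd 1 2 (by decide), Or.inl ?_, ?_⟩
  · have := hPa 0
    rwa [(hsource 0 _ (ha 0)).2 rfl] at this
  · obtain ⟨i, hi⟩ := hτ 0
    have := hPb i
    rw [(hsink _ _ (hb i)).2 hi] at this
    fin_cases i
    · exact Or.inl this
    · exact Or.inr (Or.inl this)
    · exact Or.inr (Or.inr this)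
end

section
/- Let G be a simple graph, let u and v be distinct vertices of G, and let {u,u'} be an edge of G. Suppose there exist three pairwise internally vertex-disjoint paths P'₁, P'₂, P'₃ from u to v, and suppose there exists a path Q from u' to v that does not visit u. Then there exist three pairwise internally vertex-disjoint paths P₁, P₂, P₃ from u to v such that the edge {u,u'} is an edge of one of the three paths. -/
open SimpleGraph

theorem InternallyDisjoint.symm {V : Type*} {G : SimpleGraph V} {u v : V}
    {p q : G.Walk u v} (h : InternallyDisjoint p q) : InternallyDisjoint q p :=
  fun w hq hp => h w hp hq

/-- A walk ending in `S` has an initial part that meets `S` only in its last vertex. -/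
theorem SimpleGraph.Walk.exists_walk_to_first_mem {V : Type*} {G : SimpleGraph V} (S : Set V)
    {a b : V} (q : G.Walk a b) (hb : b ∈ S) :
    ∃ w ∈ S, ∃ r : G.Walk a w, r.support ⊆ q.support ∧ ∀ x ∈ r.support, x ∈ S → x = w := by
  induction q with
  | nil => exact ⟨_, hb, .nil, by simp, by simp⟩
  | @cons a c b h q ih =>
    by_cases ha : a ∈ S
    · exact ⟨a, ha, .nil, by simp, by simp⟩
    · obtain ⟨w, hw, r, hr, hS⟩ := ih hb
      refine ⟨w, hw, .cons h r, ?_, ?_⟩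
      · simpa using List.subset_cons_of_subset a hr
      · intro x hx hxS
        rcases List.mem_cons.mp (r.support_cons h ▸ hx) with rfl | hx
        · exact absurd hxS ha
        · exact hS x hx hxS

theorem SimpleGraph.Walk.IsPath.start_notMem_support_dropUntil {V : Type*} [DecidableEq V]
    {G : SimpleGraph V} {u v w : V} {p : G.Walk u v} (hp : p.IsPath) (hw : w ∈ p.support)
    (hwu : w ≠ u) : u ∉ (p.dropUntil w hw).support := by
  intro hu
  have hnd := hp.support_nodup
  rw [← p.take_spec hw, Walk.support_append] at hnd
  rw [Walk.mem_support_iff] at hu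
  exact (List.nodup_append.mp hnd).2.2 u (Walk.start_mem_support _) u
    (hu.resolve_left hwu.symm) rfl

/-- If a walk from a neighbour `a` of `u` reaches a `u`–`v` path `p` while avoiding `u`, then
`p` can be rerouted through the edge `{u, a}` along that walk. -/
theorem SimpleGraph.Walk.IsPath.exists_reroute {V : Type*} {G : SimpleGraph V} {u v a w : V}
    {p : G.Walk u v} (hp : p.IsPath) (hua : G.Adj u a) (hw : w ∈ p.support)
    (r : G.Walk a w) (hr : u ∉ r.support) :
    ∃ p' : G.Walk u v, p'.IsPath ∧ s(u, a) ∈ p'.edges ∧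
      ∀ x ∈ p'.support, x = u ∨ x ∈ r.support ∨ x ∈ p.support := by
  classical
  have hwu : w ≠ u := fun h => hr (h ▸ r.end_mem_support)
  let t := r.append (p.dropUntil w hw)
  have hsub := t.support_bypass_subset_support
  refine ⟨.cons hua t.bypass, ?_, by simp, fun x hx => ?_⟩
  · refine (Walk.cons_isPath_iff _ _).mpr ⟨t.bypass_isPath, fun hu => ?_⟩
    rcases Walk.mem_support_append_iff _ _ |>.mp (hsub hu) with h | h
    · exact hr h
    · exact hp.start_notMem_support_dropUntil hw hwu h
  · rw [Walk.support_cons, List.mem_cons] at hx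
    refine hx.imp_right fun hx => ?_
    exact ((Walk.mem_support_append_iff _ _).mp (hsub hx)).imp_right
      fun h => p.support_dropUntil_subset_support hw h

/-- Rerouting the path `p` of three internally disjoint paths that the walk `r` meets first. -/
theorem exists_internallyDisjoint_reroute {V : Type*} {G : SimpleGraph V} {u v a w : V}
    {p q₁ q₂ : G.Walk u v} (hp : p.IsPath) (h₁ : InternallyDisjoint p q₁)
    (h₂ : InternallyDisjoint p q₂) (hua : G.Adj u a) (hw : w ∈ p.support)
    (r : G.Walk a w) (hr : u ∉ r.support)
    (hr₁ : ∀ x ∈ r.support, x ∈ q₁.support → x = w)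
    (hr₂ : ∀ x ∈ r.support, x ∈ q₂.support → x = w) :
    ∃ p' : G.Walk u v, p'.IsPath ∧ s(u, a) ∈ p'.edges ∧
      InternallyDisjoint p' q₁ ∧ InternallyDisjoint p' q₂ := by
  obtain ⟨p', hp', he, hsupp⟩ := hp.exists_reroute hua hw r hr
  have key : ∀ q : G.Walk u v, InternallyDisjoint p q →
      (∀ x ∈ r.support, x ∈ q.support → x = w) → InternallyDisjoint p' q := by
    intro q hq hrq x hx hxq
    rcases hsupp x hx with h | h | h
    · exact .inl h
    · obtain rfl := hrq x h hxq
      exact hq x hw hxq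
    · exact hq x h hxq
  exact ⟨p', hp', he, key q₁ h₁ hr₁, key q₂ h₂ hr₂⟩

theorem stmt_2 {V : Type*} (G : SimpleGraph V) (u v u' : V) (huv : u ≠ v)
    (heu : G.Adj u u')
    (P₁' P₂' P₃' : G.Walk u v)
    (hP₁' : P₁'.IsPath) (hP₂' : P₂'.IsPath) (hP₃' : P₃'.IsPath)
    (h₁₂ : InternallyDisjoint P₁' P₂') (h₁₃ : InternallyDisjoint P₁' P₃')
    (h₂₃ : InternallyDisjoint P₂' P₃')
    (Q : G.Walk u' v) (hQ : Q.IsPath) (hQu : u ∉ Q.support) :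
    ∃ P₁ P₂ P₃ : G.Walk u v,
      P₁.IsPath ∧ P₂.IsPath ∧ P₃.IsPath ∧
      InternallyDisjoint P₁ P₂ ∧ InternallyDisjoint P₁ P₃ ∧
      InternallyDisjoint P₂ P₃ ∧
      (s(u, u') ∈ P₁.edges ∨ s(u, u') ∈ P₂.edges ∨ s(u, u') ∈ P₃.edges) := by
  obtain ⟨w, hw, R, hRQ, hR⟩ := Q.exists_walk_to_first_mem
    {x | x ∈ P₁'.support ∨ x ∈ P₂'.support ∨ x ∈ P₃'.support} (.inl P₁'.end_mem_support)
  have hRu : u ∉ R.support := fun h => hQu (hRQ h)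
  have hR₁ : ∀ x ∈ R.support, x ∈ P₁'.support → x = w := fun x hx h => hR x hx (.inl h)
  have hR₂ : ∀ x ∈ R.support, x ∈ P₂'.support → x = w := fun x hx h => hR x hx (.inr (.inl h))
  have hR₃ : ∀ x ∈ R.support, x ∈ P₃'.support → x = w := fun x hx h => hR x hx (.inr (.inr h))
  rcases hw with hw | hw | hw
  · obtain ⟨P, hP, he, h₂, h₃⟩ :=
      exists_internallyDisjoint_reroute hP₁' h₁₂ h₁₃ heu hw R hRu hR₂ hR₃
    exact ⟨P, P₂', P₃', hP, hP₂', hP₃', h₂, h₃, h₂₃, .inl he⟩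
  · obtain ⟨P, hP, he, h₁, h₃⟩ :=
      exists_internallyDisjoint_reroute hP₂' h₁₂.symm h₂₃ heu hw R hRu hR₁ hR₃
    exact ⟨P₁', P, P₃', hP₁', hP, hP₃', h₁.symm, h₁₃, h₃, .inr (.inl he)⟩
  · obtain ⟨P, hP, he, h₁, h₂⟩ :=
      exists_internallyDisjoint_reroute hP₃' h₁₃.symm h₂₃.symm heu hw R hRu hR₁ hR₂
    exact ⟨P₁', P₂', P, hP₁', hP₂', hP, h₁₂, h₁.symm, h₂.symm, .inr (.inr he)⟩
end
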